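/- Symmetry of the electromagnetic energy–momentum tensor at the Clifford-algebra level (𝒯_a · ϑ_b = 𝒯_b · ϑ_a): for every antisymmetric real 4×4 matrix G and all indices a, b ∈ Fin 4, if u and w are vectors in Fin 4 → ℝ with ι Q u = (1/2) • (Φ * γ a * reverse Φ) and ι Q w = (1/2) • (Φ * γ b * reverse Φ), then B u (e b) = B w (e a). -/

import Mathlib

noncomputable section

open CliffordAlgebra Finset Matrix

/-- The Minkowski metric matrix `diag(1,-1,-1,-1)`. -/
def η : Matrix (Fin 4) (Fin 4) ℝ := Matrix.diagonal ![1, -1, -1, -1]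

/-- The Minkowski quadratic form on `Fin 4 → ℝ`:
`Q x = (x 0)^2 - (x 1)^2 - (x 2)^2 - (x 3)^2`. -/
def Q : QuadraticForm ℝ (Fin 4 → ℝ) :=
  QuadraticMap.weightedSumSquares ℝ ![(1 : ℝ), -1, -1, -1]

/-- The bilinear form associated with `Q`. -/
def B (x y : Fin 4 → ℝ) : ℝ := (Q (x + y) - Q x - Q y) / 2

/-- The standard basis of `Fin 4 → ℝ`. -/
def e (a : Fin 4) : Fin 4 → ℝ := Pi.single a 1

/-- The Dirac gamma `γ a = ι Q (e a)`. -/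
def γ (a : Fin 4) : CliffordAlgebra Q := ι Q (e a)

/-- The electromagnetic bivector `Φ = (1/2) F_{ab} γ^a γ^b`
(indices raised with `η`). -/
def Φ (G : Matrix (Fin 4) (Fin 4) ℝ) : CliffordAlgebra Q :=
  (1 / 2 : ℝ) • ∑ a : Fin 4, ∑ b : Fin 4, (η a a * η b b * G a b) • (γ a * γ b)

/-- The Dirac representation of vectors: `x ↦ x₀ γ⁰ + ∑ xᵢ γⁱ` as complex `4 × 4` matrices. -/
def diracMatrix : (Fin 4 → ℝ) →ₗ[ℝ] Matrix (Fin 4) (Fin 4) ℂ where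
  toFun x :=
    !![(x 0 : ℂ), 0, x 3, x 1 - Complex.I * x 2;
       0, x 0, x 1 + Complex.I * x 2, -x 3;
       -x 3, -x 1 + Complex.I * x 2, -x 0, 0;
       -x 1 - Complex.I * x 2, x 3, 0, -x 0]
  map_add' x y := by
    ext i j
    fin_cases i <;> fin_cases j <;> simp <;> ring
  map_smul' c x := by
    ext i j
    fin_cases i <;> fin_cases j <;> simp <;> ring

theorem diracMatrix_mul_self (x : Fin 4 → ℝ) :
    diracMatrix x * diracMatrix x = algebraMap ℝ _ (Q x) := by
  have hI : Complex.I ^ 2 = -1 := Complex.I_sq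
  ext i j
  fin_cases i <;> fin_cases j <;>
    simp [diracMatrix, Q, QuadraticMap.weightedSumSquares_apply, Matrix.mul_apply,
      Fin.sum_univ_four, Matrix.algebraMap_matrix_apply] <;> grind

/-- The Dirac representation of the Clifford algebra of Minkowski space. -/
def diracRep : CliffordAlgebra Q →ₐ[ℝ] Matrix (Fin 4) (Fin 4) ℂ :=
  lift Q ⟨diracMatrix, diracMatrix_mul_self⟩

theorem trace_diracRep_mul_comm (x y : CliffordAlgebra Q) :
    (diracRep (x * y)).trace = (diracRep (y * x)).trace := by
  rw [map_mul, map_mul, Matrix.trace_mul_comm]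

theorem trace_diracRep_ι_mul_ι (x y : Fin 4 → ℝ) :
    (diracRep (ι Q x * ι Q y)).trace = 4 * (B x y : ℂ) := by
  have h := congrArg (fun z => (diracRep z).trace) (ι_mul_ι_add_swap (Q := Q) x y)
  simp only [map_add, Matrix.trace_add, trace_diracRep_mul_comm (ι Q y), AlgHom.commutes] at h
  have hs : (algebraMap ℝ (Matrix (Fin 4) (Fin 4) ℂ) (QuadraticMap.polar Q x y)).trace
      = 8 * (B x y : ℂ) := by
    simp [Matrix.trace, Matrix.algebraMap_matrix_apply, B, QuadraticMap.polar]
    ring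
  rw [hs] at h
  linear_combination h / 2

theorem reverse_Φ (G : Matrix (Fin 4) (Fin 4) ℝ) (hG : Gᵀ = -G) :
    reverse (R := ℝ) (Φ G) = -Φ G := by
  have hG' (i j : Fin 4) : G i j = -G j i := congrFun (congrFun hG j) i
  simp only [Φ, map_smul, map_sum, reverse.map_mul, γ, reverse_ι]
  rw [← smul_neg, Finset.sum_comm, ← Finset.sum_neg_distrib]
  congr 1
  refine Finset.sum_congr rfl fun i _ => ?_
  rw [← Finset.sum_neg_distrib]
  refine Finset.sum_congr rfl fun j _ => ?_
  rw [hG' j i, ← neg_smul]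
  congr 1
  ring

/-- Symmetry of the electromagnetic energy–momentum tensor:
`𝒯_a · ϑ_b = 𝒯_b · ϑ_a`. -/
theorem energy_momentum_symm (G : Matrix (Fin 4) (Fin 4) ℝ) (hG : Gᵀ = -G)
    (a b : Fin 4) (u v : Fin 4 → ℝ)
    (hu : ι Q u = (1 / 2 : ℝ) • (Φ G * γ a * reverse (R := ℝ) (Φ G)))
    (hv : ι Q v = (1 / 2 : ℝ) • (Φ G * γ b * reverse (R := ℝ) (Φ G))) :
    B u (e b) = B v (e a) := by
  rw [reverse_Φ G hG] at hu hv
  have h : (diracRep (ι Q u * γ b)).trace = (diracRep (ι Q v * γ a)).trace := by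
    rw [hu, hv]
    simp only [smul_mul_assoc, mul_neg, neg_mul, map_smul, map_neg]
    rw [mul_assoc (Φ G * γ a), Matrix.trace_smul, Matrix.trace_neg, trace_diracRep_mul_comm,
      ← mul_assoc, Matrix.trace_smul, Matrix.trace_neg]
  rw [γ, γ, trace_diracRep_ι_mul_ι, trace_diracRep_ι_mul_ι] at h
  exact_mod_cast mul_left_cancel₀ (by norm_num : (4 : ℂ) ≠ 0) h
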